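/- The automorphism group of the Petersen graph is isomorphic, as a group, to the symmetric group S_5 = Perm(Fin 5); moreover, the natural map sending σ ∈ Perm(Fin 5) to the induced permutation of 2-element subsets is such an isomorphism onto the full automorphism group. -/

import Mathlib

open SimpleGraph

/-- The Petersen graph: vertices are the 2-element subsets of `Fin 5`,
adjacent iff disjoint. -/
def petersen : SimpleGraph {s : Finset (Fin 5) // s.card = 2} where
  Adj a b := Disjoint a.1 b.1
  symm := ⟨fun _ _ h => h.symm⟩
  loopless := ⟨fun a h => by
    have : a.1 = ∅ := disjoint_self.mp h
    have h2 := a.2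
    rw [this] at h2
    simp at h2⟩

/-- The permutation of the vertices of the Petersen graph (2-element subsets of
`Fin 5`) induced by a permutation of `Fin 5`, acting elementwise. -/
def vertEquiv (σ : Equiv.Perm (Fin 5)) :
    {s : Finset (Fin 5) // s.card = 2} ≃ {s : Finset (Fin 5) // s.card = 2} where
  toFun a := ⟨a.1.image σ, by rw [Finset.card_image_of_injective _ σ.injective]; exact a.2⟩
  invFun a := ⟨a.1.image (⇑(σ⁻¹)), by rw [Finset.card_image_of_injective _ (σ⁻¹).injective]; exact a.2⟩
  left_inv a := Subtype.ext (by simp [Finset.image_image, Equiv.symm_comp_self, Equiv.self_comp_symm, Equiv.Perm.inv_def])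
  right_inv a := Subtype.ext (by simp [Finset.image_image, Equiv.symm_comp_self, Equiv.self_comp_symm, Equiv.Perm.inv_def])

/-- The natural map from `S₅` to the automorphisms of the Petersen graph. -/
def petersenAut (σ : Equiv.Perm (Fin 5)) : petersen ≃g petersen where
  toEquiv := vertEquiv σ
  map_rel_iff' := fun {a b} => Finset.disjoint_image σ.injective

set_option synthInstance.maxSize 2000 in
set_option synthInstance.maxHeartbeats 400000 in
set_option maxHeartbeats 2000000 in
theorem pet_star_aux : ∀ a ∈ (Finset.univ : Finset (Fin 5)).powersetCard 2,
    ∀ b ∈ (Finset.univ : Finset (Fin 5)).powersetCard 2, a ≠ b → ¬ Disjoint a b →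
    ∀ c ∈ (Finset.univ : Finset (Fin 5)).powersetCard 2, a ≠ c → b ≠ c →
    ¬ Disjoint a c → ¬ Disjoint b c →
    ∀ d ∈ (Finset.univ : Finset (Fin 5)).powersetCard 2, a ≠ d → b ≠ d → c ≠ d →
    ¬ Disjoint a d → ¬ Disjoint b d → ¬ Disjoint c d →
    ∃ j, j ∈ a ∧ j ∈ b ∧ j ∈ c ∧ j ∈ d := by
  decide +kernel

theorem pet_star (S : Finset (Finset (Fin 5)))
    (hS : S ∈ ((Finset.univ : Finset (Fin 5)).powersetCard 2).powersetCard 4)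
    (h : ∀ p ∈ S, ∀ q ∈ S, ¬ Disjoint p q) : ∃ j, ∀ p ∈ S, j ∈ p := by
  obtain ⟨hsub, hc⟩ := Finset.mem_powersetCard.1 hS
  obtain ⟨a, S1, ha, rfl, hc1⟩ := Finset.card_eq_succ.1 hc
  obtain ⟨b, c, d, hbc, hbd, hcd, rfl⟩ := Finset.card_eq_three.1 hc1
  simp only [Finset.mem_insert, Finset.mem_singleton, not_or] at ha
  obtain ⟨j, h1, h2, h3, h4⟩ := pet_star_aux a (hsub (by simp)) b (hsub (by simp)) ha.1
    (h _ (by simp) _ (by simp)) c (hsub (by simp)) ha.2.1 hbc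
    (h _ (by simp) _ (by simp)) (h _ (by simp) _ (by simp))
    d (hsub (by simp)) ha.2.2 hbd hcd
    (h _ (by simp) _ (by simp)) (h _ (by simp) _ (by simp)) (h _ (by simp) _ (by simp))
  exact ⟨j, by simp [h1, h2, h3, h4]⟩

theorem pet_pt (i k : Fin 5)
    (h : ∀ p : {s : Finset (Fin 5) // s.card = 2}, i ∈ p.1 → k ∈ p.1) : k = i := by
  have h' : ∀ p ∈ (Finset.univ : Finset (Fin 5)).powersetCard 2, i ∈ p → k ∈ p :=
    fun p hp => h ⟨p, (Finset.mem_powersetCard.1 hp).2⟩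
  clear h
  revert i k
  decide +kernel

theorem pet_starcard (i : Fin 5) :
    (((Finset.univ : Finset (Fin 5)).powersetCard 2).filter (fun p => i ∈ p)).card = 4 := by
  revert i
  decide +kernel

theorem pet_map (f : petersen ≃g petersen) :
    ∃ g : Fin 5 → Fin 5, ∀ i p, i ∈ p.1 → g i ∈ (f p).1 := by
  have key : ∀ i : Fin 5, ∃ j, ∀ p, i ∈ p.1 → j ∈ (f p).1 := by
    intro i
    let T : Finset {s : Finset (Fin 5) // s.card = 2} := Finset.univ.filter (fun p => i ∈ p.1)
    have hT : T.card = 4 := by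
      rw [← pet_starcard i, ← Finset.card_image_of_injective T Subtype.val_injective]
      congr 1
      ext p
      simp [T, Finset.mem_powersetCard, and_comm]
    have hinj : Function.Injective (fun p => (f p).1) :=
      Subtype.val_injective.comp f.injective
    obtain ⟨j, hj⟩ := pet_star (T.image (fun p => (f p).1)) (by
      rw [Finset.mem_powersetCard, Finset.card_image_of_injective _ hinj]
      refine ⟨?_, hT⟩
      intro q hq
      obtain ⟨p, -, rfl⟩ := Finset.mem_image.1 hq
      exact Finset.mem_powersetCard.2 ⟨Finset.subset_univ _, (f p).2⟩) (by
      intro p hp q hq hd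
      obtain ⟨a, ha, rfl⟩ := Finset.mem_image.1 hp
      obtain ⟨b, hb, rfl⟩ := Finset.mem_image.1 hq
      have hab : Disjoint a.1 b.1 := f.map_rel_iff.1 hd
      exact Finset.disjoint_left.1 hab (Finset.mem_filter.1 ha).2 (Finset.mem_filter.1 hb).2)
    exact ⟨j, fun p hp => hj _ (Finset.mem_image_of_mem _ (by simp [T, hp]))⟩
  choose g hg using key
  exact ⟨g, hg⟩

/-- The natural map `S₅ → Aut(Petersen)` is a group isomorphism onto the full
automorphism group of the Petersen graph: it is bijective and sends
multiplication to composition. -/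
theorem petersen_automorphism_group :
    Function.Bijective petersenAut ∧
    ∀ σ τ : Equiv.Perm (Fin 5),
      petersenAut (σ * τ) = (petersenAut τ).trans (petersenAut σ) := by
  refine ⟨⟨?_, ?_⟩, ?_⟩
  · intro σ τ h
    ext1 i
    have h2 : ∀ p : {s : Finset (Fin 5) // s.card = 2}, p.1.image σ = p.1.image τ :=
      fun p => congrArg Subtype.val (DFunLike.congr_fun h p)
    have := pet_pt i (τ.symm (σ i)) (fun p hp => by
      have h3 : σ i ∈ p.1.image τ := h2 p ▸ Finset.mem_image_of_mem _ hp
      obtain ⟨k, hk, hk2⟩ := Finset.mem_image.1 h3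
      rw [← hk2]; simpa using hk)
    rw [Equiv.symm_apply_eq] at this
    exact this
  · intro f
    obtain ⟨g, hg⟩ := pet_map f
    obtain ⟨k, hk⟩ := pet_map f.symm
    have h1 : ∀ i, k (g i) = i := fun i => pet_pt _ _ (fun p hp => by
      simpa using hk _ _ (hg i p hp))
    have h2 : ∀ i, g (k i) = i := fun i => pet_pt _ _ (fun p hp => by
      simpa using hg _ _ (hk i p hp))
    refine ⟨⟨g, k, h1, h2⟩, ?_⟩
    refine DFunLike.ext _ _ (fun p => Subtype.ext ?_)
    refine Finset.eq_of_subset_of_card_le ?_ ?_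
    · intro x hx
      obtain ⟨y, hy, rfl⟩ := Finset.mem_image.1 hx
      exact hg y p hy
    · rw [(f p).2, (petersenAut _ p).2]
  · intro σ τ
    refine DFunLike.ext _ _ (fun p => Subtype.ext ?_)
    change p.1.image (σ * τ) = (p.1.image τ).image σ
    rw [Finset.image_image]; rfl
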